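/- arXiv:2012.01090 — 2 statements merged into one kernel-verified Lean document; each statement's English description precedes it below -/
import Mathlib

section
/- Let n ≥ 5 and let G be a connected graph on n vertices with exactly one pendant vertex. Then ε(G) ≤ ⌊(3n² − 4n − 3)/4⌋, and equality holds if and only if G is isomorphic to U_{n,3}^l. -/
open SimpleGraph

/-- The eccentricity of a vertex: maximum distance to any vertex. -/
noncomputable def ecc {V : Type*} (G : SimpleGraph V) (v : V) : ℕ :=
  ⨆ u, G.dist v u

/-- The total eccentricity index: sum of eccentricities of all vertices. -/
noncomputable def totalEcc {V : Type*} [Fintype V] (G : SimpleGraph V) : ℕ :=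
  ∑ v, ecc G v

/-- A pendant vertex: a vertex of degree one, i.e. with exactly one neighbour. -/
def IsPendant {V : Type*} (G : SimpleGraph V) (v : V) : Prop :=
  ∃! u, G.Adj v u

/-- A cut vertex: a vertex whose removal disconnects the graph. -/
def IsCutVertex {V : Type*} (G : SimpleGraph V) (w : V) : Prop :=
  ¬ (G.induce {v | v ≠ w}).Connected

/-- distance between two subgraphs -/
noncomputable def subgraphDist {V : Type*} (G : SimpleGraph V) (B B' : G.Subgraph) : ℕ :=
  sInf {d | ∃ u ∈ B.verts, ∃ w ∈ B'.verts, G.dist u w = d}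

/-- A 2-connected subgraph: at least two vertices, connected, and no cut vertex. -/
def TwoConn {V : Type*} {G : SimpleGraph V} (H : G.Subgraph) : Prop :=
  2 ≤ H.verts.ncard ∧ H.coe.Connected ∧ ∀ w, ¬ IsCutVertex H.coe w

/-- A block: a maximal 2-connected subgraph. -/
def IsBlock {V : Type*} {G : SimpleGraph V} (H : G.Subgraph) : Prop :=
  TwoConn H ∧ ∀ H' : G.Subgraph, H ≤ H' → TwoConn H' → H' = H

/-- A pendant block: a block containing exactly one cut vertex of `G`. -/
def IsPendantBlock {V : Type*} (G : SimpleGraph V) (H : G.Subgraph) : Prop :=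
  ∃! w, w ∈ H.verts ∧ IsCutVertex G w

/-- `G_{k,l}`: the graph obtained from `G` by attaching two new paths,
with `k` resp. `l` new vertices, at the vertex `v`. -/
def attachTwoPaths {V : Type*} (G : SimpleGraph V) (v : V) (k l : ℕ) :
    SimpleGraph (V ⊕ (Fin k ⊕ Fin l)) :=
  SimpleGraph.fromRel (fun p q =>
    match p, q with
    | .inl x, .inl y => G.Adj x y
    | .inl x, .inr (.inl i) => x = v ∧ i.val = 0
    | .inl x, .inr (.inr i) => x = v ∧ i.val = 0
    | .inr (.inl i), .inr (.inl j) => i.val + 1 = j.val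
    | .inr (.inr i), .inr (.inr j) => i.val + 1 = j.val
    | _, _ => False)

/-- The graph obtained from `H1`, `H2` and the path `P_d = v_1 v_2 … v_d` by identifying
`u ∈ V(H1)`, `v ∈ V(H2)` and `v_1` into a single vertex.  The `Fin (d-1)` part records the
path vertices `v_2, …, v_d`. -/
def glueMid {V1 V2 : Type*} (H1 : SimpleGraph V1) (H2 : SimpleGraph V2)
    (u : V1) (v : V2) (d : ℕ) :
    SimpleGraph (V1 ⊕ ({x : V2 // x ≠ v} ⊕ Fin (d - 1))) :=
  SimpleGraph.fromRel (fun p q =>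
    match p, q with
    | .inl x, .inl y => H1.Adj x y
    | .inl x, .inr (.inl y) => x = u ∧ H2.Adj v y.1
    | .inl x, .inr (.inr i) => x = u ∧ i.val = 0
    | .inr (.inl x), .inr (.inl y) => H2.Adj x.1 y.1
    | .inr (.inr i), .inr (.inr j) => i.val + 1 = j.val
    | _, _ => False)

/-- The graph obtained from `H1`, `H2` and the path `P_d = v_1 v_2 … v_d` by identifying
`u ∈ V(H1)` with `v_1` and `v ∈ V(H2)` with `v_d`.  The `Fin (d-1)` part records the path
vertices `v_2, …, v_d` (the last one being identified with `v`). -/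
def glueEnds {V1 V2 : Type*} (H1 : SimpleGraph V1) (H2 : SimpleGraph V2)
    (u : V1) (v : V2) (d : ℕ) :
    SimpleGraph (V1 ⊕ ({x : V2 // x ≠ v} ⊕ Fin (d - 1))) :=
  SimpleGraph.fromRel (fun p q =>
    match p, q with
    | .inl x, .inl y => H1.Adj x y
    | .inl x, .inr (.inr i) => x = u ∧ i.val = 0
    | .inr (.inl x), .inr (.inl y) => H2.Adj x.1 y.1
    | .inr (.inr i), .inr (.inl y) => i.val + 1 = d - 1 ∧ H2.Adj v y.1
    | .inr (.inr i), .inr (.inr j) => i.val + 1 = j.val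
    | _, _ => False)

/-- `U_{n,g}^l`: the unicyclic graph on `n` vertices obtained by joining one end vertex of
the path `P_{n-g}` to a vertex of the cycle `C_g` by an edge. -/
def UnlGraph (n g : ℕ) : SimpleGraph (Fin (n - g) ⊕ Fin g) :=
  SimpleGraph.fromRel (fun p q =>
    match p, q with
    | .inl i, .inl j => i.val + 1 = j.val
    | .inl i, .inr j => i.val + 1 = n - g ∧ j.val = 0
    | .inr i, .inr j => i.val + 1 = j.val ∨ (i.val = 0 ∧ j.val + 1 = g)
    | _, _ => False)

/-- `U_{n,g}^p`: the unicyclic graph on `n` vertices obtained by attaching `n - g` pendant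
vertices to one vertex of the cycle `C_g`. -/
def UnpGraph (n g : ℕ) : SimpleGraph (Fin g ⊕ Fin (n - g)) :=
  SimpleGraph.fromRel (fun p q =>
    match p, q with
    | .inl i, .inl j => i.val + 1 = j.val ∨ (i.val = 0 ∧ j.val + 1 = g)
    | .inl i, .inr _ => i.val = 0
    | _, _ => False)

/-- The graph obtained by joining the vertex `u` of `H` to the pendant vertex of
`U_{r,g}^l` by an edge. -/
def joinPendant {V : Type*} (H : SimpleGraph V) (u : V) (r g : ℕ) :
    SimpleGraph (V ⊕ (Fin (r - g) ⊕ Fin g)) :=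
  SimpleGraph.fromRel (fun p q =>
    match p, q with
    | .inl x, .inl y => H.Adj x y
    | .inl x, .inr (.inl i) => x = u ∧ i.val = 0
    | .inr a, .inr b => (UnlGraph r g).Adj a b
    | _, _ => False)

/-- `C_{m1,m2}^n` in the case `n = m1 + m2 - 1`: two cycles `C_{m1}` and `C_{m2}`
sharing exactly one vertex (the vertex `0`). -/
def twoCyclesGlued (m1 m2 : ℕ) : SimpleGraph (Fin (m1 + m2 - 1)) :=
  SimpleGraph.fromRel (fun i j =>
    (i.val + 1 = j.val ∧ j.val < m1) ∨ (i.val = 0 ∧ j.val + 1 = m1)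
    ∨ (i.val = 0 ∧ j.val = m1) ∨ (m1 ≤ i.val ∧ i.val + 1 = j.val)
    ∨ (i.val = 0 ∧ j.val + 2 = m1 + m2))

/-- `C_{3,3}^n` for `n > 5`: two triangles `{0,1,2}` and `{n-3,n-2,n-1}` joined by the path
`2, 3, …, n-3` (a path on `n - 4` vertices whose ends are identified with a vertex of each
triangle). -/
def C33 (n : ℕ) : SimpleGraph (Fin n) :=
  SimpleGraph.fromRel (fun i j =>
    (i.val = 0 ∧ j.val = 1) ∨ (i.val = 0 ∧ j.val = 2) ∨ (i.val = 1 ∧ j.val = 2)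
    ∨ (2 ≤ i.val ∧ i.val + 1 = j.val ∧ j.val + 3 ≤ n)
    ∨ (i.val + 3 = n ∧ j.val + 2 = n) ∨ (i.val + 2 = n ∧ j.val + 1 = n)
    ∨ (i.val + 3 = n ∧ j.val + 1 = n))

/-- `T(l, m, d)`: the tree obtained from the path `P_d` by attaching `l` pendant vertices at
one end and `m` pendant vertices at the other end. -/
def Tlmd (l m d : ℕ) : SimpleGraph (Fin d ⊕ (Fin l ⊕ Fin m)) :=
  SimpleGraph.fromRel (fun p q =>
    match p, q with
    | .inl i, .inl j => i.val + 1 = j.val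
    | .inl i, .inr (.inl _) => i.val = 0
    | .inl i, .inr (.inr _) => i.val + 1 = d
    | _, _ => False)

/-- `K_m^n(l_1, …, l_m)`: the graph obtained from the complete graph `K_m` by identifying,
for each `i`, one end vertex of a path on `l i` vertices with the `i`-th vertex of `K_m`.
The vertex `⟨i, 0⟩` is the `i`-th vertex of the complete graph. -/
def Kmn (m : ℕ) (l : Fin m → ℕ) : SimpleGraph ((i : Fin m) × Fin (l i)) :=
  SimpleGraph.fromRel (fun p q =>
    (p.1 = q.1 ∧ p.2.val + 1 = q.2.val) ∨ (p.1 ≠ q.1 ∧ p.2.val = 0 ∧ q.2.val = 0))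

/-- The graph obtained from `H`, `C_{m1}` and `C_{m2}` by identifying the vertex `w` of `H`,
a vertex of `C_{m1}` and a vertex of `C_{m2}` into one vertex. -/
def glueTwoCycles {V : Type*} (H : SimpleGraph V) (w : V) (m1 m2 : ℕ) :
    SimpleGraph (V ⊕ (Fin (m1 - 1) ⊕ Fin (m2 - 1))) :=
  SimpleGraph.fromRel (fun p q =>
    match p, q with
    | .inl x, .inl y => H.Adj x y
    | .inl x, .inr (.inl i) => x = w ∧ (i.val = 0 ∨ i.val + 2 = m1)
    | .inl x, .inr (.inr i) => x = w ∧ (i.val = 0 ∨ i.val + 2 = m2)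
    | .inr (.inl i), .inr (.inl j) => i.val + 1 = j.val
    | .inr (.inr i), .inr (.inr j) => i.val + 1 = j.val
    | _, _ => False)

/-- The graph obtained from `H` and the cycle `C_M` by identifying the vertex `w` of `H`
with one vertex of the cycle. -/
def glueOneCycle {V : Type*} (H : SimpleGraph V) (w : V) (M : ℕ) :
    SimpleGraph (V ⊕ Fin (M - 1)) :=
  SimpleGraph.fromRel (fun p q =>
    match p, q with
    | .inl x, .inl y => H.Adj x y
    | .inl x, .inr i => x = w ∧ (i.val = 0 ∨ i.val + 2 = M)
    | .inr i, .inr j => i.val + 1 = j.val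
    | _, _ => False)

section Eccentricity

variable {V : Type*} {G : SimpleGraph V}

lemma ecc_le {x : V} {k : ℕ} (h : ∀ y, G.dist x y ≤ k) : ecc G x ≤ k :=
  ciSup_le' h

variable [Fintype V]

lemma dist_le_ecc (G : SimpleGraph V) (x y : V) : G.dist x y ≤ ecc G x :=
  le_ciSup (f := fun u => G.dist x u) (Set.finite_range _).bddAbove y

lemma exists_dist_eq_ecc (G : SimpleGraph V) (x : V) : ∃ y, G.dist x y = ecc G x :=
  have : Nonempty V := ⟨x⟩
  exists_eq_ciSup_of_finite (f := fun u => G.dist x u)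

lemma ecc_anti {H : SimpleGraph V} (hle : H ≤ G) (hH : H.Connected) (x : V) :
    ecc G x ≤ ecc H x :=
  ecc_le fun y => (Reachable.dist_anti hle (hH x y)).trans (dist_le_ecc H x y)

end Eccentricity

/-- The vertices `u 0, …, u D` form a shortest path of length `D`. -/
def IsGeodesic {V : Type*} (G : SimpleGraph V) (D : ℕ) (u : ℕ → V) : Prop :=
  ∀ i j, i ≤ j → j ≤ D → i + G.dist (u i) (u j) = j

section Geodesic

variable {V : Type*} {G : SimpleGraph V} {D : ℕ} {u : ℕ → V}

lemma exists_isGeodesic (hG : G.Connected) (a b : V) :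
    ∃ u : ℕ → V, u 0 = a ∧ u (G.dist a b) = b ∧ IsGeodesic G (G.dist a b) u := by
  obtain ⟨p, hp⟩ := hG.exists_walk_length_eq_dist a b
  refine ⟨p.getVert, p.getVert_zero, by rw [← hp, p.getVert_length], ?_⟩
  have upper : ∀ i k, i + k ≤ p.length → G.dist (p.getVert i) (p.getVert (i + k)) ≤ k := by
    intro i k
    induction k with
    | zero => simp
    | succ k ih =>
      intro h
      have h1 := ih (by omega)
      have h2 := dist_eq_one_iff_adj.mpr (p.adj_getVert_succ (i := i + k) (by omega))
      have h3 := hG.dist_triangle (u := p.getVert i) (v := p.getVert (i + k))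
        (w := p.getVert (i + k + 1))
      rw [← add_assoc]
      omega
  intro i j hij hj
  have h1 := upper 0 i (by omega)
  have h2 := upper i (j - i) (by omega)
  have h3 := upper j (p.length - j) (by omega)
  rw [Nat.add_sub_cancel' hij] at h2
  rw [Nat.add_sub_cancel' (by omega), p.getVert_length] at h3
  rw [zero_add, p.getVert_zero] at h1
  have h4 := hG.dist_triangle (u := a) (v := p.getVert i) (w := p.getVert j)
  have h5 := hG.dist_triangle (u := a) (v := p.getVert j) (w := b)
  omega

lemma IsGeodesic.reverse (hu : IsGeodesic G D u) : IsGeodesic G D (fun i => u (D - i)) := by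
  intro i j hij hj
  have := hu (D - j) (D - i) (by omega) (by omega)
  rw [dist_comm] at this
  dsimp only
  omega

lemma IsGeodesic.injOn (hu : IsGeodesic G D u) :
    Set.InjOn u (Finset.range (D + 1) : Set ℕ) := by
  intro i hi j hj h
  simp only [Finset.coe_range, Set.mem_Iio] at hi hj
  rcases le_total i j with hij | hij
  · simpa [h] using hu i j hij (by omega)
  · simpa [h] using (hu j i hij (by omega)).symm

lemma IsGeodesic.adj_iff (hu : IsGeodesic G D u) {i j : ℕ} (hi : i ≤ D) (hj : j ≤ D) :
    G.Adj (u i) (u j) ↔ i + 1 = j ∨ j + 1 = i := by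
  rw [← dist_eq_one_iff_adj]
  rcases le_total i j with hij | hij
  · have := hu i j hij hj
    omega
  · have := hu j i hij hi
    rw [dist_comm] at this
    omega

lemma IsGeodesic.le_dist_add_dist (hG : G.Connected) (hu : IsGeodesic G D u) (x : V) {i j : ℕ}
    (hij : i ≤ j) (hj : j ≤ D) : j ≤ i + G.dist (u i) x + G.dist x (u j) := by
  have h1 := hu i j hij hj
  have h2 := hG.dist_triangle (u := u i) (v := x) (w := u j)
  omega

lemma IsGeodesic.card_image (hu : IsGeodesic G D u) [DecidableEq V] :
    ((Finset.range (D + 1)).image u).card = D + 1 := by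
  rw [Finset.card_image_of_injOn hu.injOn, Finset.card_range]

end Geodesic

section Tree

variable {V : Type*} {T : SimpleGraph V}

lemma SimpleGraph.IsTree.eq_of_adj_of_dist_add_one (hT : T.IsTree) {a s v t : V} (hv : T.Adj s v)
    (ht : T.Adj s t) (hva : T.dist v a + 1 = T.dist s a) (hta : T.dist t a + 1 = T.dist s a) :
    v = t := by
  obtain ⟨p, hp⟩ := hT.connected.exists_walk_length_eq_dist v a
  obtain ⟨q, hq⟩ := hT.connected.exists_walk_length_eq_dist t a
  have h1 := (Walk.cons hv p).isPath_of_length_eq_dist (by simp [hp, hva])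
  have h2 := (Walk.cons ht q).isPath_of_length_eq_dist (by simp [hq, hta])
  have h3 := (hT.isAcyclic.subsingleton_path s a).elim ⟨_, h1⟩ ⟨_, h2⟩
  simpa using congrArg (fun p : T.Path s a => p.1.getVert 1) h3

/-- In a tree, a path leading away from `a` in its first step leads away from `a` throughout. -/
lemma SimpleGraph.IsTree.dist_eq_add_of_isPath_cons (hT : T.IsTree) (a : V) {s u : V}
    (p : T.Walk s u) : ∀ {v : V} (h : T.Adj v s), (Walk.cons h p).IsPath →
      T.dist s a = T.dist v a + 1 → T.dist u a = T.dist v a + (p.length + 1) := by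
  induction p with
  | nil => intro v h _ h1; simpa using h1
  | @cons s t u hst p ih =>
    intro v h hp h1
    rw [Walk.cons_isPath_iff] at hp
    have hne : v ≠ t := by
      rintro rfl
      exact hp.2 (by simp)
    have hta : T.dist t a = T.dist s a + 1 := by
      have h2 := hT.dist_eq_dist_add_one_of_adj a hst
      rw [dist_comm (u := a), dist_comm (u := a)] at h2
      rcases h2 with h2 | h2
      · exact absurd (hT.eq_of_adj_of_dist_add_one h.symm hst h1.symm h2.symm) hne
      · exact h2
    have := ih hst hp.1 hta
    simp only [Walk.length_cons]
    omega

/-- If `v` lies between `a` and `b` in a tree, then it lies between `u` and one of them. -/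
lemma SimpleGraph.IsTree.dist_eq_add_or (hT : T.IsTree) {a b v : V}
    (h : T.dist v a + T.dist v b = T.dist a b) (u : V) :
    T.dist u a = T.dist v a + T.dist v u ∨ T.dist u b = T.dist v b + T.dist v u := by
  obtain ⟨p, hp⟩ := hT.connected.exists_walk_length_eq_dist v u
  have hpath := p.isPath_of_length_eq_dist hp
  cases p with
  | nil => simp
  | @cons _ s _ hs p =>
    rw [← hp, Walk.length_cons]
    have ha := hT.dist_eq_dist_add_one_of_adj a hs
    have hb := hT.dist_eq_dist_add_one_of_adj b hs
    rw [dist_comm (u := a), dist_comm (u := a)] at ha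
    rw [dist_comm (u := b), dist_comm (u := b)] at hb
    rcases ha with ha | ha
    · rcases hb with hb | hb
      · have := hT.connected.dist_triangle (u := a) (v := s) (w := b)
        rw [dist_comm (u := a) (v := s)] at this
        omega
      · exact .inr (hT.dist_eq_add_of_isPath_cons b p hs hpath hb)
    · exact .inl (hT.dist_eq_add_of_isPath_cons a p hs hpath ha)

lemma SimpleGraph.IsTree.ecc_le_of_isGeodesic [Fintype V] (hT : T.IsTree) {D : ℕ} {u : ℕ → V}
    (hu : IsGeodesic T D u) (hD : ∀ x, ecc T x ≤ D) {i : ℕ} (hi : i ≤ D) :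
    ecc T (u i) ≤ max i (D - i) := by
  refine ecc_le fun y => ?_
  have h0 := hu 0 i (by omega) hi
  have h1 := hu i D hi le_rfl
  have h2 := hu 0 D (by omega) le_rfl
  rw [dist_comm] at h0
  have h3 := (dist_le_ecc T y (u 0)).trans (hD y)
  have h4 := (dist_le_ecc T y (u D)).trans (hD y)
  rcases hT.dist_eq_add_or (a := u 0) (b := u D) (v := u i) (by omega) y with h | h <;> omega

end Tree

/-- The total eccentricity of a path of length `D`. -/
def pathTotalEcc (D : ℕ) : ℕ := ∑ i ∈ Finset.range (D + 1), max i (D - i)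

lemma pathTotalEcc_add_two (D : ℕ) :
    pathTotalEcc (D + 2) = pathTotalEcc D + (D + 1) + 2 * (D + 2) := by
  unfold pathTotalEcc
  rw [Finset.sum_range_succ, Finset.sum_range_succ']
  have : ∀ i ∈ Finset.range (D + 1), max (i + 1) (D + 2 - (i + 1)) = max i (D - i) + 1 := by
    intro i hi
    rw [Finset.mem_range] at hi
    omega
  rw [Finset.sum_congr rfl this, Finset.sum_add_distrib]
  simp
  omega

lemma four_mul_pathTotalEcc (D : ℕ) :
    4 * pathTotalEcc D = 3 * D ^ 2 + 4 * D + D % 2 := by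
  induction D using Nat.twoStepInduction with
  | zero => simp [pathTotalEcc]
  | one => simp [pathTotalEcc, Finset.sum_range_succ]
  | more D ih _ =>
    rw [pathTotalEcc_add_two, Nat.add_mod_right]
    linarith

lemma pathTotalEcc_add_eq {n D : ℕ} (hn : n = D + 2) :
    pathTotalEcc D + D = (3 * n ^ 2 - 4 * n - 3) / 4 := by
  subst hn
  have h := four_mul_pathTotalEcc D
  have h1 : 3 * (D + 2) ^ 2 = 3 * D ^ 2 + 12 * D + 12 := by ring
  rw [h1]
  omega

lemma pathTotalEcc_add_mul_lt {D k : ℕ} (hk : 0 < k) :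
    pathTotalEcc D + (k + 1) * D < pathTotalEcc (D + k) + (D + k) := by
  have h := four_mul_pathTotalEcc D
  have h' := four_mul_pathTotalEcc (D + k)
  have : D % 2 < 2 := Nat.mod_lt _ two_pos
  nlinarith [Nat.zero_le (D * k), Nat.zero_le (k ^ 2), Nat.zero_le ((D + k) % 2)]

section Bound

variable {V : Type*} [Fintype V] {G : SimpleGraph V} {D : ℕ} {u : ℕ → V}

lemma IsGeodesic.totalEcc_le (hu : IsGeodesic G D u) {B : ℕ}
    (hpath : ∀ i ≤ D, ecc G (u i) ≤ max i (D - i))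
    (hrest : ∀ x, (∀ i ≤ D, x ≠ u i) → ecc G x ≤ B) :
    totalEcc G ≤ pathTotalEcc D + (Fintype.card V - (D + 1)) * B := by
  classical
  set S := (Finset.range (D + 1)).image u with hS
  rw [totalEcc, ← Finset.sum_add_sum_compl S]
  refine add_le_add ?_ ?_
  · rw [hS, Finset.sum_image hu.injOn]
    refine Finset.sum_le_sum fun i hi => hpath i ?_
    rw [Finset.mem_range] at hi
    omega
  · refine (Finset.sum_le_card_nsmul _ _ B fun x hx => hrest x fun i hi h => ?_).trans ?_
    · rw [Finset.mem_compl] at hx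
      exact hx (Finset.mem_image.mpr ⟨i, by simp; omega, h.symm⟩)
    · rw [Finset.card_compl, hS, hu.card_image, smul_eq_mul]

lemma IsGeodesic.add_two_le_card (hu : IsGeodesic G D u) [DecidableRel G.Adj] {c : V}
    (hc : 3 ≤ G.degree c) : D + 2 ≤ Fintype.card V := by
  classical
  by_contra! hlt
  have huniv : (Finset.range (D + 1)).image u = Finset.univ := by
    rw [← Finset.card_eq_iff_eq_univ]
    exact le_antisymm (Finset.card_le_univ _) (by rw [hu.card_image]; omega)
  have hsurj : ∀ x, ∃ i ≤ D, u i = x := by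
    intro x
    have : x ∈ (Finset.range (D + 1)).image u := huniv ▸ Finset.mem_univ x
    obtain ⟨i, hi, rfl⟩ := Finset.mem_image.mp this
    exact ⟨i, by simpa [Nat.lt_succ_iff] using hi, rfl⟩
  obtain ⟨k, hk, rfl⟩ := hsurj c
  have hsub : G.neighborFinset (u k) ⊆ {u (k - 1), u (k + 1)} := by
    intro x hx
    rw [mem_neighborFinset] at hx
    obtain ⟨i, hi, rfl⟩ := hsurj x
    rcases (hu.adj_iff hk hi).mp hx with rfl | rfl <;> simp
  have := (Finset.card_le_card hsub).trans Finset.card_le_two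
  rw [card_neighborFinset_eq_degree] at this
  omega

end Bound

lemma exists_three_le_degree {V : Type*} [Fintype V] {G : SimpleGraph V} [DecidableRel G.Adj]
    {v : V} (hpend : {v | IsPendant G v} = {v}) : ∃ c, 3 ≤ G.degree c := by
  classical
  by_contra! hdeg
  have hmem : ∀ x, G.degree x = 1 ↔ x = v := by
    intro x
    rw [degree_eq_one_iff_existsUnique_adj]
    exact Set.ext_iff.mp hpend x
  have hodd : Finset.univ.filter (fun x => Odd (G.degree x)) = {v} := by
    ext x
    have := hdeg x
    simp only [Finset.mem_filter, Finset.mem_univ, true_and, Finset.mem_singleton, ← hmem]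
    constructor
    · rintro ⟨k, hk⟩; omega
    · intro h; rw [h]; exact odd_one
  have := G.even_card_odd_degree_vertices
  simp [hodd] at this

lemma exists_isTree_le_three_le_degree {V : Type*} [Fintype V] {G : SimpleGraph V}
    [DecidableRel G.Adj] (hG : G.Connected) {c : V} (hc : 3 ≤ G.degree c) :
    ∃ T : SimpleGraph V, T ≤ G ∧ T.IsTree ∧ ∃ _ : DecidableRel T.Adj, 3 ≤ T.degree c := by
  classical
  obtain ⟨T, hle, hTG, hT⟩ := hG.exists_isTree_le_of_le_of_isAcyclic
    (H := G ⊓ starGraph c) inf_le_left ((isAcyclic_starGraph c).anti inf_le_right)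
  refine ⟨T, hTG, hT, inferInstance, hc.trans ?_⟩
  rw [← card_neighborFinset_eq_degree, ← card_neighborFinset_eq_degree]
  refine Finset.card_le_card fun x hx => ?_
  rw [mem_neighborFinset] at hx ⊢
  exact hle ⟨hx, starGraph_adj.mpr ⟨hx.ne, .inl rfl⟩⟩

lemma exists_isGeodesic_forall_ecc_le {V : Type*} [Fintype V] {G : SimpleGraph V}
    (hG : G.Connected) : ∃ D u, IsGeodesic G D u ∧ ∀ x, ecc G x ≤ D := by
  have := hG.nonempty
  obtain ⟨a, ha⟩ := Finite.exists_max (ecc G)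
  obtain ⟨b, hb⟩ := exists_dist_eq_ecc G a
  obtain ⟨u, -, -, hu⟩ := exists_isGeodesic hG a b
  exact ⟨_, u, hu, fun x => hb ▸ ha x⟩

/-- The total eccentricity of a connected graph with a vertex of degree at least three is at most
that of `U_{n,3}^l`, with strict inequality unless some shortest path has length `n - 2`. -/
lemma totalEcc_le_and_lt_or_exists_isGeodesic {V : Type*} [Fintype V] {G : SimpleGraph V}
    [DecidableRel G.Adj] (hG : G.Connected) {D : ℕ} (hcard : Fintype.card V = D + 2) {c : V}
    (hc : 3 ≤ G.degree c) :
    totalEcc G ≤ pathTotalEcc D + D ∧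
      (totalEcc G < pathTotalEcc D + D ∨ ∃ u, IsGeodesic G D u) := by
  obtain ⟨T, hTG, hT, _, hTc⟩ := exists_isTree_le_three_le_degree hG hc
  obtain ⟨d, u, hu, hd⟩ := exists_isGeodesic_forall_ecc_le hT.connected
  have hdD := hu.add_two_le_card hTc
  have hTsum := hu.totalEcc_le (fun i hi => hT.ecc_le_of_isGeodesic hu hd hi) (fun x _ => hd x)
  have hle : totalEcc G ≤ totalEcc T := Finset.sum_le_sum fun x _ => ecc_anti hTG hT.connected x
  obtain ⟨k, rfl⟩ : ∃ k, D = d + k := ⟨D - d, by omega⟩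
  rw [hcard, show d + k + 2 - (d + 1) = k + 1 by omega] at hTsum
  rcases Nat.eq_zero_or_pos k with rfl | hk
  · simp only [add_zero, zero_add, one_mul] at hTsum ⊢
    refine ⟨hle.trans hTsum, ?_⟩
    by_cases h : ecc G (u 0) = d
    · obtain ⟨b, hb⟩ := exists_dist_eq_ecc G (u 0)
      obtain ⟨w, -, -, hw⟩ := exists_isGeodesic hG (u 0) b
      rw [hb, h] at hw
      exact .inr ⟨w, hw⟩
    · refine .inl (lt_of_lt_of_le ?_ hTsum)
      have h0 := hu 0 d (by omega) le_rfl
      have h1 := dist_le_ecc T (u 0) (u d)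
      have h2 := ecc_anti hTG hT.connected (u 0)
      have h3 := hd (u 0)
      exact Finset.sum_lt_sum (fun x _ => ecc_anti hTG hT.connected x)
        ⟨u 0, Finset.mem_univ _, by omega⟩
  · have := pathTotalEcc_add_mul_lt (D := d) hk
    exact ⟨by omega, .inl (by omega)⟩

section Extremal

variable {V : Type*} [Fintype V] {G : SimpleGraph V} {D : ℕ} {u : ℕ → V} {w : V}

lemma IsGeodesic.exists_forall_ne (hu : IsGeodesic G D u) (hcard : Fintype.card V = D + 2) :
    ∃ w, (∀ i ≤ D, u i ≠ w) ∧ ∀ x, x = w ∨ ∃ i ≤ D, x = u i := by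
  classical
  have hcompl : ((Finset.range (D + 1)).image u)ᶜ.card = 1 := by
    rw [Finset.card_compl, hu.card_image]
    omega
  obtain ⟨w, hw⟩ := Finset.card_eq_one.mp hcompl
  have hmem : ∀ x, (∀ i ≤ D, u i ≠ x) ↔ x = w := by
    intro x
    rw [← Finset.mem_singleton, ← hw]
    simp
  refine ⟨w, (hmem w).mpr rfl, fun x => ?_⟩
  by_cases h : x = w
  · exact .inl h
  · rw [← hmem] at h
    push Not at h
    obtain ⟨i, hi, h⟩ := h
    exact .inr ⟨i, hi, h.symm⟩

lemma IsGeodesic.totalEcc_lt_of_adj (hG : G.Connected) (hu : IsGeodesic G D u) (hD : 3 ≤ D)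
    (hcard : Fintype.card V = D + 2) (hcover : ∀ x, x = w ∨ ∃ i ≤ D, x = u i)
    (h0 : G.Adj w (u 0)) (h2 : G.Adj w (u 2)) : totalEcc G < pathTotalEcc D + D := by
  have hw : ∀ i ≤ D, G.dist w (u i) ≤ max i (D - i) ∧ G.dist w (u i) ≤ D - 1 := by
    intro i hi
    rw [← dist_eq_one_iff_adj] at h0 h2
    have t0 := hG.dist_triangle (u := w) (v := u 0) (w := u i)
    have t2 := hG.dist_triangle (u := w) (v := u 2) (w := u i)
    have g0 := hu 0 i (by omega) hi
    rcases Nat.lt_or_ge i 2 with h | h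
    · omega
    · have g2 := hu 2 i h hi
      omega
  have key := hu.totalEcc_le (B := D - 1) (fun i hi => ecc_le fun y => ?_)
    (fun x hx => ecc_le fun y => ?_)
  · rw [hcard, show D + 2 - (D + 1) = 1 by omega] at key
    omega
  · rcases hcover y with rfl | ⟨j, hj, rfl⟩
    · rw [SimpleGraph.dist_comm]
      exact (hw i hi).1
    · rcases le_total i j with h | h
      · have := hu i j h hj
        omega
      · have := hu j i h hi
        rw [SimpleGraph.dist_comm] at this
        omega
  · obtain rfl : x = w := (hcover x).resolve_right fun ⟨i, hi, h⟩ => hx i hi h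
    rcases hcover y with rfl | ⟨j, hj, rfl⟩
    · simp
    · exact (hw j hj).2

lemma IsGeodesic.nonempty_iso_unlGraph (hu : IsGeodesic G D u) (hD : 3 ≤ D)
    (hcard : Fintype.card V = D + 2) (hw : ∀ i ≤ D, u i ≠ w)
    (hadj : ∀ i ≤ D, G.Adj w (u i) ↔ i ≤ 1) : Nonempty (G ≃g UnlGraph (D + 2) 3) := by
  let f : Fin (D + 2 - 3) ⊕ Fin 3 → V := Sum.elim (fun i => u (D - i)) ![u 1, u 0, w]
  have hne : ∀ i ≤ D, w ≠ u i := fun i hi => (hw i hi).symm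
  have hinj : ∀ i j, i ≤ D → j ≤ D → (u i = u j ↔ i = j) := by
    refine fun i j hi hj => ⟨fun h => hu.injOn ?_ ?_ h, fun h => h ▸ rfl⟩ <;>
      · simp only [Finset.coe_range, Set.mem_Iio]
        omega
  have hf : Function.Injective f := by
    rintro (i | i) (j | j) h
    · have := i.2
      have := j.2
      simp only [f, Sum.elim_inl] at h
      rw [hinj _ _ (by omega) (by omega)] at h
      congr 1
      ext
      omega
    · have := i.2
      fin_cases j <;> simp [f] at h
      · rw [hinj _ _ (by omega) (by omega)] at h
        omega
      · rw [hinj _ _ (by omega) (by omega)] at h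
        omega
      · exact absurd h (hw _ (by omega))
    · have := j.2
      fin_cases i <;> simp [f] at h
      · rw [hinj _ _ (by omega) (by omega)] at h
        omega
      · rw [hinj _ _ (by omega) (by omega)] at h
        omega
      · exact absurd h (hne _ (by omega))
    · fin_cases i <;> fin_cases j <;>
        simp [f, hinj 0 1 (by omega) (by omega), hinj 1 0 (by omega) (by omega), hw 0 (by omega),
          hw 1 (by omega), hne 0 (by omega), hne 1 (by omega)] at h ⊢
  have hbij : Function.Bijective f := by
    rw [Fintype.bijective_iff_injective_and_card]
    refine ⟨hf, ?_⟩
    simp only [Fintype.card_sum, Fintype.card_fin]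
    omega
  have hadj' : ∀ i ≤ D, G.Adj (u i) w ↔ i ≤ 1 := fun i hi => G.adj_comm _ _ |>.trans (hadj i hi)
  refine ⟨RelIso.symm ⟨Equiv.ofBijective f hbij, ?_⟩⟩
  intro x y
  simp only [Equiv.ofBijective_apply]
  rcases x with i | i <;> rcases y with j | j
  · have := i.2
    have := j.2
    simp only [f, Sum.elim_inl, UnlGraph, fromRel_adj, ne_eq, Sum.inl.injEq, Fin.ext_iff]
    rw [hu.adj_iff (by omega) (by omega)]
    omega
  · have := i.2
    have h1 := hu.adj_iff (i := D - i) (j := 1) (by omega) (by omega)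
    have h2 := hu.adj_iff (i := D - i) (j := 0) (by omega) (by omega)
    have h3 := hadj' (D - i) (by omega)
    fin_cases j <;> simp [f, UnlGraph, fromRel_adj, h1, h2, h3] <;> omega
  · have := j.2
    have h1 := hu.adj_iff (i := 1) (j := D - j) (by omega) (by omega)
    have h2 := hu.adj_iff (i := 0) (j := D - j) (by omega) (by omega)
    have h3 := hadj (D - j) (by omega)
    fin_cases i <;> simp [f, UnlGraph, fromRel_adj, h1, h2, h3] <;> omega
  · have h1 := hu.adj_iff (i := 1) (j := 0) (by omega) (by omega)
    have h2 := hu.adj_iff (i := 0) (j := 1) (by omega) (by omega)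
    fin_cases i <;> fin_cases j <;>
      simp [f, UnlGraph, fromRel_adj, h1, h2, hadj 0 (by omega), hadj 1 (by omega),
        hadj' 0 (by omega), hadj' 1 (by omega)]

lemma IsGeodesic.totalEcc_lt_or_nonempty_iso_of_adj (hG : G.Connected) (hu : IsGeodesic G D u)
    (hD : 3 ≤ D) (hcard : Fintype.card V = D + 2) (hpend : {v | IsPendant G v}.Subsingleton)
    (hw : ∀ i ≤ D, u i ≠ w) (hcover : ∀ x, x = w ∨ ∃ i ≤ D, x = u i) (h0 : G.Adj w (u 0)) :
    totalEcc G < pathTotalEcc D + D ∨ Nonempty (G ≃g UnlGraph (D + 2) 3) := by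
  have hfar : ∀ i ≤ D, G.Adj w (u i) → i ≤ 2 := by
    intro i hi h
    have h1 := hu.le_dist_add_dist hG w (Nat.zero_le i) hi
    rw [dist_eq_one_iff_adj.mpr h0.symm, dist_eq_one_iff_adj.mpr h] at h1
    omega
  have hlast : IsPendant G (u D) := by
    refine ⟨u (D - 1), (hu.adj_iff le_rfl (by omega)).mpr (by omega), fun y hy => ?_⟩
    rcases hcover y with rfl | ⟨j, hj, rfl⟩
    · have := hfar D le_rfl hy.symm
      omega
    · have := (hu.adj_iff le_rfl hj).mp hy
      congr 1
      omega
  by_cases h2 : G.Adj w (u 2)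
  · exact .inl (hu.totalEcc_lt_of_adj hG hD hcard hcover h0 h2)
  · refine .inr (hu.nonempty_iso_unlGraph hD hcard hw ?_)
    have h1 : G.Adj w (u 1) := by
      by_contra h1
      refine hw D le_rfl (hpend hlast ⟨u 0, h0, fun y hy => ?_⟩)
      rcases hcover y with rfl | ⟨j, hj, rfl⟩
      · exact absurd hy (G.irrefl)
      · have := hfar j hj hy
        interval_cases j <;> trivial
    intro i hi
    refine ⟨fun h => ?_, fun h => ?_⟩
    · have := hfar i hi h
      by_contra h'
      obtain rfl : i = 2 := by omega
      exact h2 h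
    · interval_cases i <;> assumption

lemma IsGeodesic.totalEcc_lt_or_nonempty_iso (hG : G.Connected) (hu : IsGeodesic G D u)
    (hD : 3 ≤ D) (hcard : Fintype.card V = D + 2) (hpend : {v | IsPendant G v}.Subsingleton) :
    totalEcc G < pathTotalEcc D + D ∨ Nonempty (G ≃g UnlGraph (D + 2) 3) := by
  obtain ⟨w, hw, hcover⟩ := hu.exists_forall_ne hcard
  by_cases h0 : G.Adj w (u 0)
  · exact hu.totalEcc_lt_or_nonempty_iso_of_adj hG hD hcard hpend hw hcover h0
  by_cases hlast : G.Adj w (u D)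
  · refine hu.reverse.totalEcc_lt_or_nonempty_iso_of_adj hG hD hcard hpend
      (fun i _ => hw (D - i) (by omega)) (fun x => (hcover x).imp_right ?_) (by simpa using hlast)
    rintro ⟨i, hi, rfl⟩
    exact ⟨D - i, by omega, by rw [Nat.sub_sub_self hi]⟩
  have hfirst : IsPendant G (u 0) := by
    refine ⟨u 1, (hu.adj_iff (by omega) (by omega)).mpr (by omega), fun y hy => ?_⟩
    rcases hcover y with rfl | ⟨j, hj, rfl⟩
    · exact absurd hy.symm h0
    · have := (hu.adj_iff (by omega) hj).mp hy
      congr 1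
      omega
  have hend : IsPendant G (u D) := by
    refine ⟨u (D - 1), (hu.adj_iff le_rfl (by omega)).mpr (by omega), fun y hy => ?_⟩
    rcases hcover y with rfl | ⟨j, hj, rfl⟩
    · exact absurd hy.symm hlast
    · have := (hu.adj_iff le_rfl hj).mp hy
      congr 1
      omega
  have := hu 0 D (by omega) le_rfl
  rw [hpend hfirst hend, dist_self] at this
  omega

end Extremal

lemma abs_sub_le_dist_of_adj {V : Type*} {G : SimpleGraph V} (hG : G.Connected) {f : V → ℤ}
    (hf : ∀ x y, G.Adj x y → |f x - f y| ≤ 1) (x y : V) : |f x - f y| ≤ G.dist x y := by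
  obtain ⟨p, hp⟩ := hG.exists_walk_length_eq_dist x y
  rw [← hp]
  clear hp
  induction p with
  | nil => simp
  | @cons a b c h p ih =>
    have h1 := hf a b h
    have h2 := abs_sub_le (f a) (f b) (f c)
    rw [Walk.length_cons]
    push_cast
    linarith

lemma le_totalEcc_unlGraph {V : Type*} [Fintype V] {G : SimpleGraph V} (hG : G.Connected) {D : ℕ}
    (hD : 1 ≤ D) (e : G ≃g UnlGraph (D + 2) 3) : pathTotalEcc D + D ≤ totalEcc G := by
  let f : Fin (D + 2 - 3) ⊕ Fin 3 → ℕ := Sum.elim (fun i => i) ![D - 1, D, D]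
  have hf : ∀ x y, (UnlGraph (D + 2) 3).Adj x y → |(f x : ℤ) - f y| ≤ 1 := by
    intro x y hxy
    rw [abs_le]
    rcases x with i | i <;> rcases y with j | j
    · simp [UnlGraph, fromRel_adj, f] at hxy ⊢
      omega
    · have := i.2
      fin_cases j <;> simp [UnlGraph, fromRel_adj, f] at hxy ⊢ <;> omega
    · have := j.2
      fin_cases i <;> simp [UnlGraph, fromRel_adj, f] at hxy ⊢ <;> omega
    · fin_cases i <;> fin_cases j <;> simp [f] <;> omega
  have hdist : ∀ x y, |(f (e x) : ℤ) - f (e y)| ≤ G.dist x y :=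
    abs_sub_le_dist_of_adj (f := fun x => (f (e x) : ℤ)) hG
      fun x y h => hf _ _ (e.map_adj_iff.mpr h)
  have hDmem : ∃ y, f (e y) = D := ⟨e.symm (.inr 1), by simp [f]⟩
  have h0mem : ∃ y, f (e y) = 0 := by
    rcases Nat.lt_or_ge 1 D with h | h
    · exact ⟨e.symm (.inl ⟨0, by omega⟩), by simp [f]⟩
    · exact ⟨e.symm (.inr 0), by simp [f]; omega⟩
  have hecc : ∀ x, max (f (e x)) (D - f (e x)) ≤ ecc G x := by
    intro x
    obtain ⟨y, hy⟩ := hDmem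
    obtain ⟨z, hz⟩ := h0mem
    have h1 := hdist x y
    have h2 := hdist x z
    rw [abs_le, hy] at h1
    rw [abs_le, hz] at h2
    have h3 := dist_le_ecc G x y
    have h4 := dist_le_ecc G x z
    omega
  refine le_trans (le_of_eq ?_) (Finset.sum_le_sum fun x _ => hecc x)
  have hsum := Equiv.sum_comp e.toEquiv fun y => max (f y) (D - f y)
  refine Eq.trans ?_ hsum.symm
  rw [Fintype.sum_sum_type, Fin.sum_univ_three]
  obtain ⟨d, rfl⟩ : ∃ d, D = d + 1 := ⟨D - 1, by omega⟩
  have hpath : ∑ i : Fin (d + 1 + 2 - 3), max (f (.inl i)) (d + 1 - f (.inl i))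
      = ∑ i ∈ Finset.range d, max i (d + 1 - i) :=
    Fin.sum_univ_eq_sum_range (fun i => max i (d + 1 - i)) d
  rw [hpath, pathTotalEcc, Finset.sum_range_succ, Finset.sum_range_succ]
  simp [f, add_assoc]

-- STATEMENT 9
theorem stmt9 {V : Type*} [Fintype V] (G : SimpleGraph V) (hG : G.Connected)
    (n : ℕ) (hn : 5 ≤ n) (hcard : Fintype.card V = n)
    (hpend : {v | IsPendant G v}.ncard = 1) :
    totalEcc G ≤ (3 * n ^ 2 - 4 * n - 3) / 4 ∧
    (totalEcc G = (3 * n ^ 2 - 4 * n - 3) / 4 ↔ Nonempty (G ≃g UnlGraph n 3)) := by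
  classical
  obtain ⟨D, rfl⟩ : ∃ D, n = D + 2 := ⟨n - 2, by omega⟩
  obtain ⟨v, hv⟩ := Set.ncard_eq_one.mp hpend
  obtain ⟨c, hc⟩ := exists_three_le_degree hv
  obtain ⟨hle, hcases⟩ := totalEcc_le_and_lt_or_exists_isGeodesic hG hcard hc
  rw [← pathTotalEcc_add_eq rfl]
  refine ⟨hle, fun heq => ?_, fun ⟨e⟩ => le_antisymm hle (le_totalEcc_unlGraph hG (by omega) e)⟩
  obtain ⟨u, hu⟩ := hcases.resolve_left heq.not_lt
  exact (hu.totalEcc_lt_or_nonempty_iso hG (by omega) hcard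
    (hv ▸ Set.subsingleton_singleton)).resolve_left heq.not_lt
end

section
/- Let n ≥ 7 and let G be a connected graph on n vertices with no pendant vertex. Then ε(G) ≤ ⌊(3n² − 6n − 8)/4⌋, and equality holds if and only if G is isomorphic to C_{3,3}^n. -/
open SimpleGraph

section Eccentricity

variable {V : Type*} {G : SimpleGraph V}

theorem ecc_le_s10 [Nonempty V] {v : V} {m : ℕ} (h : ∀ u, G.dist v u ≤ m) : ecc G v ≤ m :=
  ciSup_le h

theorem dist_le_ecc_s10 [Finite V] (v u : V) : G.dist v u ≤ ecc G v :=
  le_ciSup (f := fun u => G.dist v u) (Set.finite_range _).bddAbove u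

theorem dist_le_dist_add_one (hG : G.Connected) {a u v : V} (h : G.Adj u v) :
    G.dist a v ≤ G.dist a u + 1 := by
  have := hG.dist_triangle (u := a) (v := u) (w := v)
  rwa [SimpleGraph.dist_eq_one_iff_adj.2 h] at this

/-- A function which increases by at most one along each edge is a lower bound for distances. -/
theorem le_add_dist_of_adj (hG : G.Connected) {f : V → ℕ}
    (hf : ∀ u v, G.Adj u v → f v ≤ f u + 1) (u v : V) : f v ≤ f u + G.dist u v := by
  obtain ⟨p, hp⟩ := hG.exists_walk_length_eq_dist u v
  rw [← hp]
  clear hp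
  induction p with
  | nil => simp
  | cons h p ih =>
    have := hf _ _ h
    rw [SimpleGraph.Walk.length_cons]
    omega

/-- A geodesic meets every layer of the distance partition lying between its ends. -/
theorem exists_dist_eq_on_geodesic (hG : G.Connected) {a u w : V} {i : ℕ}
    (hu : G.dist a u ≤ i) (hw : i ≤ G.dist a w) :
    ∃ x, G.dist a x = i ∧ G.dist u x + G.dist x w = G.dist u w := by
  suffices H : ∀ (u w : V) (p : G.Walk u w), G.dist a u ≤ i → i ≤ G.dist a w →
      ∃ x, G.dist a x = i ∧ G.dist u x + G.dist x w ≤ p.length by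
    obtain ⟨p, hp⟩ := hG.exists_walk_length_eq_dist u w
    obtain ⟨x, hx, hle⟩ := H u w p hu hw
    exact ⟨x, hx, le_antisymm (hp ▸ hle) hG.dist_triangle⟩
  intro u w p
  induction p with
  | nil => exact fun h₁ h₂ => ⟨_, le_antisymm h₁ h₂, by simp⟩
  | @cons u u' w h p ih =>
    intro h₁ h₂
    rw [SimpleGraph.Walk.length_cons]
    rcases h₁.eq_or_lt with h₁ | h₁
    · refine ⟨u, h₁, ?_⟩
      have := SimpleGraph.dist_le (p.cons h)
      simpa using this
    · have h' := dist_le_dist_add_one hG (a := a) h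
      obtain ⟨x, hx, hle⟩ := ih (by omega) h₂
      refine ⟨x, hx, ?_⟩
      have := hG.dist_triangle (u := u) (v := u') (w := x)
      rw [SimpleGraph.dist_eq_one_iff_adj.2 h] at this
      omega

theorem exists_adj_of_dist_eq_add_one (hG : G.Connected) {a v : V} {i : ℕ}
    (h : G.dist a v = i + 1) : ∃ u, G.dist a u = i ∧ G.Adj u v := by
  obtain ⟨x, hx, hs⟩ := exists_dist_eq_on_geodesic hG (a := a) (u := a) (w := v) (i := i)
    (by simp) (by omega)
  exact ⟨x, hx, SimpleGraph.dist_eq_one_iff_adj.1 (by omega)⟩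

theorem exists_ne_adj_of_not_isPendant {v a : V} (hv : ¬ IsPendant G v) (h : G.Adj v a) :
    ∃ b, b ≠ a ∧ G.Adj v b := by
  by_contra! H
  exact hv ⟨a, h, fun b hb => by_contra fun hne => H b hne hb⟩

/-- A vertex alone in its layer lies on a geodesic from the root to every farther vertex. -/
theorem dist_add_dist_eq_of_layer (hG : G.Connected) {a x w : V}
    (hx : ∀ w, G.dist a w = G.dist a x → w = x) (hw : G.dist a x ≤ G.dist a w) :
    G.dist a x + G.dist x w = G.dist a w := by
  obtain ⟨z, hz, hs⟩ := exists_dist_eq_on_geodesic hG (a := a) (u := a) (by simp) hw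
  rwa [hx z hz] at hs

/-- If `a`, `y` is a diametral pair, a vertex alone in its layer with respect to `a` is as
close to all other vertices as on a path. -/
theorem dist_add_min_le (hG : G.Connected) {d : ℕ} (hmax : ∀ u w, G.dist u w ≤ d)
    {a y x : V} (hy : G.dist a y = d) (hx : ∀ w, G.dist a w = G.dist a x → w = x) (w : V) :
    G.dist x w + min (G.dist a x) (d - G.dist a x) ≤ d := by
  rcases le_total (G.dist a x) (G.dist a w) with h | h
  · have := dist_add_dist_eq_of_layer hG hx h
    have := hmax a w
    omega
  · obtain ⟨z, hz, hs⟩ := exists_dist_eq_on_geodesic hG (a := a) (w := y) h (hy ▸ hmax a x)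
    rw [hx z hz, SimpleGraph.dist_comm] at hs
    have := dist_add_dist_eq_of_layer hG hx (w := y) (hy ▸ hmax a x)
    have := hmax w y
    omega

theorem sum_min_sub (d : ℕ) : ∑ i ∈ Finset.range (d + 1), min i (d - i) = d ^ 2 / 4 := by
  induction d using Nat.twoStepInduction with
  | zero => simp
  | one => simp [Finset.sum_range_succ]
  | more d ih _ =>
    rw [Finset.sum_range_succ, Finset.sum_range_succ']
    have : ∀ i ∈ Finset.range (d + 1), min (i + 1) (d + 2 - (i + 1)) = min i (d - i) + 1 := by
      intro i hi
      have := Finset.mem_range.1 hi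
      omega
    rw [Finset.sum_congr rfl this, Finset.sum_add_distrib, ih]
    have : (d + 2) ^ 2 = d ^ 2 + 4 * (d + 1) := by ring
    simp
    omega

variable [Fintype V]

open Classical in
theorem totalEcc_add_sum_le {d : ℕ} {a : V} (hmax : ∀ w, G.dist a w ≤ d) {D : ℕ → ℕ}
    (hD : ∀ i ≤ d, (∑ v with G.dist a v = i, ecc G v) + D i ≤
      d * (Finset.univ.filter fun v => G.dist a v = i).card) :
    totalEcc G + ∑ i ∈ Finset.range (d + 1), D i ≤ d * Fintype.card V := by
  have hm : ∀ v ∈ (Finset.univ : Finset V), G.dist a v ∈ Finset.range (d + 1) :=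
    fun v _ => Finset.mem_range.2 (Nat.lt_succ_of_le (hmax v))
  rw [totalEcc, ← Finset.sum_fiberwise_of_maps_to hm, ← Finset.sum_add_distrib,
    ← Finset.card_univ, Finset.card_eq_sum_card_fiberwise hm, Finset.mul_sum]
  exact Finset.sum_le_sum fun i hi => hD i (Nat.lt_succ_iff.1 (Finset.mem_range.1 hi))

open Classical in
theorem sum_le_card_of_le_card_layers {d : ℕ} {a : V} (hmax : ∀ w, G.dist a w ≤ d) {c : ℕ → ℕ}
    (hc : ∀ i ≤ d, c i ≤ (Finset.univ.filter fun v => G.dist a v = i).card) :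
    ∑ i ∈ Finset.range (d + 1), c i ≤ Fintype.card V := by
  have hm : ∀ v ∈ (Finset.univ : Finset V), G.dist a v ∈ Finset.range (d + 1) :=
    fun v _ => Finset.mem_range.2 (Nat.lt_succ_of_le (hmax v))
  rw [← Finset.card_univ, Finset.card_eq_sum_card_fiberwise hm]
  exact Finset.sum_le_sum fun i hi => hc i (Nat.lt_succ_iff.1 (Finset.mem_range.1 hi))

open Classical in
theorem one_le_card_layer (hG : G.Connected) {a y : V} {i : ℕ} (hi : i ≤ G.dist a y) :
    1 ≤ (Finset.univ.filter fun v => G.dist a v = i).card := by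
  obtain ⟨x, hx, -⟩ := exists_dist_eq_on_geodesic hG (a := a) (u := a) (by simp) hi
  exact Finset.card_pos.2 ⟨x, by simp [hx]⟩

open Classical in
theorem sum_layer_ecc_add_min_le (hG : G.Connected) {d : ℕ} (hmax : ∀ u w, G.dist u w ≤ d)
    {a y : V} (hy : G.dist a y = d) {i : ℕ}
    (hi : (Finset.univ.filter fun v => G.dist a v = i).card = 1) :
    (∑ v with G.dist a v = i, ecc G v) + min i (d - i) ≤
      d * (Finset.univ.filter fun v => G.dist a v = i).card := by
  have := hG.nonempty
  obtain ⟨x, hx⟩ := Finset.card_eq_one.1 hi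
  have hmem : ∀ w, G.dist a w = i ↔ w = x := fun w => by
    simpa using Finset.ext_iff.1 hx w
  have hxi : G.dist a x = i := (hmem x).2 rfl
  have hdist := dist_add_min_le hG hmax hy (x := x) (by rw [hxi]; exact fun w => (hmem w).1)
  rw [hxi] at hdist
  have : ecc G x ≤ d - min i (d - i) := ecc_le_s10 fun w => by have := hdist w; omega
  rw [hx, Finset.sum_singleton, Finset.card_singleton]
  omega

theorem exists_diametral_pair [Nonempty V] (G : SimpleGraph V) :
    ∃ a y, ∀ u w, G.dist u w ≤ G.dist a y := by
  obtain ⟨⟨a, y⟩, -, h⟩ := Finset.exists_max_image (Finset.univ : Finset (V × V))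
    (fun p => G.dist p.1 p.2) Finset.univ_nonempty
  exact ⟨a, y, fun u w => h (u, w) (Finset.mem_univ _)⟩

theorem totalEcc_congr {W : Type*} [Fintype W] {H : SimpleGraph W} (hG : G.Connected)
    (e : G ≃g H) : totalEcc G = totalEcc H := by
  have hH : H.Connected := e.connected_iff.1 hG
  have hd : ∀ u v, G.dist u v = H.dist (e u) (e v) := by
    intro u v
    apply le_antisymm
    · obtain ⟨p, hp⟩ := hH.exists_walk_length_eq_dist (e u) (e v)
      have := SimpleGraph.dist_le (p.map e.symm.toHom)
      rw [SimpleGraph.Walk.length_map, hp] at this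
      simpa using this
    · obtain ⟨p, hp⟩ := hG.exists_walk_length_eq_dist u v
      have := SimpleGraph.dist_le (p.map e.toHom)
      rw [SimpleGraph.Walk.length_map, hp] at this
      simpa using this
  refine Fintype.sum_equiv e.toEquiv _ _ fun v => ?_
  simp only [ecc, hd]
  exact e.toEquiv.iSup_congr fun _ => rfl

theorem le_totalEcc_C33 {n : ℕ} (hn : 7 ≤ n) (hC : (C33 n).Connected) :
    (3 * n ^ 2 - 6 * n - 8) / 4 ≤ totalEcc (C33 n) := by
  obtain ⟨d, rfl⟩ : ∃ d, n = d + 3 := ⟨n - 3, by omega⟩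
  have hf : ∀ u v : Fin (d + 3), (C33 (d + 3)).Adj u v →
      min (v.val - 1) d ≤ min (u.val - 1) d + 1 := by
    intro u v h
    simp only [C33, SimpleGraph.fromRel_adj] at h
    omega
  have hlow : ∀ v : Fin (d + 3),
      d ≤ ecc (C33 (d + 3)) v + min (min (v.val - 1) d) (d - min (v.val - 1) d) := by
    intro v
    have h₁ := le_add_dist_of_adj hC hf v ⟨d + 2, by omega⟩
    have h₂ := le_add_dist_of_adj hC hf ⟨0, by omega⟩ v
    have h₃ := dist_le_ecc_s10 (G := C33 (d + 3)) v ⟨d + 2, by omega⟩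
    have h₄ := dist_le_ecc_s10 (G := C33 (d + 3)) v ⟨0, by omega⟩
    rw [SimpleGraph.dist_comm] at h₄
    simp only at h₁ h₂
    omega
  have hsum := Finset.sum_le_sum fun v (_ : v ∈ Finset.univ) => hlow v
  rw [Finset.sum_add_distrib, Fin.sum_univ_eq_sum_range
    (fun i => min (min (i - 1) d) (d - min (i - 1) d)), Finset.sum_range_succ,
    Finset.sum_range_succ'] at hsum
  have h₁ : ∀ i ∈ Finset.range (d + 1),
      min (min (i + 1 - 1) d) (d - min (i + 1 - 1) d) = min i (d - i) := by
    intro i hi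
    have := Finset.mem_range.1 hi
    omega
  rw [Finset.sum_congr rfl h₁, sum_min_sub] at hsum
  simp only [Finset.sum_const, Finset.card_univ, Fintype.card_fin, smul_eq_mul] at hsum
  have h₂ : 3 * (d + 3) ^ 2 - 6 * (d + 3) - 8 = 3 * (d * d) + 12 * d + 1 := by
    have : 3 * (d + 3) ^ 2 = 3 * (d * d) + 12 * d + 1 + 8 + 6 * (d + 3) := by ring
    omega
  rw [h₂]
  have h₃ : (d + 3) * d = d * d + 3 * d := by ring
  rw [h₃, pow_two] at hsum
  rw [totalEcc]
  rcases Nat.even_or_odd' d with ⟨e, he | he⟩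
  · have : d * d = 4 * (e * e) := by rw [he]; ring
    omega
  · have : d * d = 4 * (e * e + e) + 1 := by rw [he]; ring
    omega

open Classical in
/-- Graphs whose diameter is at most `n - 4` are not extremal. -/
theorem totalEcc_lt_of_two_le_card_layers (hG : G.Connected) {d : ℕ}
    (hmax : ∀ u w, G.dist u w ≤ d) {a y : V} (hy : G.dist a y = d) (hd : 3 ≤ d)
    (hn : d + 4 ≤ Fintype.card V) {s : ℕ} (hs : s ≤ d) (hs' : d ≤ s + 1)
    (h1 : 2 ≤ (Finset.univ.filter fun v => G.dist a v = 1).card)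
    (h2 : 2 ≤ (Finset.univ.filter fun v => G.dist a v = s).card) :
    totalEcc G < (3 * Fintype.card V ^ 2 - 6 * Fintype.card V - 8) / 4 := by
  have := hG.nonempty
  set L : ℕ → Finset V := fun i => Finset.univ.filter fun v => G.dist a v = i with hL
  set S : Finset ℕ := (Finset.range (d + 1)).filter fun i => 2 ≤ (L i).card with hS
  have hpos : ∀ i ≤ d, 1 ≤ (L i).card := fun i hi => one_le_card_layer hG (hy ▸ hi)
  have hcard : d + 1 + S.card ≤ Fintype.card V := by
    have := sum_le_card_of_le_card_layers (G := G) (hmax a)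
      (c := fun i => 1 + if 2 ≤ (L i).card then 1 else 0) fun i hi => by
        have := hpos i hi
        change _ ≤ (L i).card
        split_ifs <;> omega
    rw [Finset.sum_add_distrib, ← Finset.card_filter] at this
    simpa using this
  have hD := totalEcc_add_sum_le (G := G) (hmax a)
    (D := fun i => if 2 ≤ (L i).card then 0 else min i (d - i)) (by
      intro i hi
      change (∑ v ∈ L i, ecc G v) + _ ≤ d * (L i).card
      have hle : ∀ v, ecc G v ≤ d := fun v => ecc_le_s10 (hmax v)
      split_ifs with h
      · rw [add_zero, mul_comm, ← smul_eq_mul]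
        exact Finset.sum_le_card_nsmul _ _ _ fun v _ => hle v
      · exact sum_layer_ecc_add_min_le hG hmax hy (le_antisymm (Nat.le_of_lt_succ (not_le.1 h)) (hpos i hi)))
  have hsplit := Finset.sum_filter_add_sum_filter_not (Finset.range (d + 1))
    (fun i => 2 ≤ (L i).card) (fun i => min i (d - i))
  rw [sum_min_sub, ← hS] at hsplit
  have hnot : ∑ i ∈ Finset.range (d + 1), (if 2 ≤ (L i).card then 0 else min i (d - i)) =
      ∑ i ∈ Finset.range (d + 1) with ¬ 2 ≤ (L i).card, min i (d - i) := by
    rw [Finset.sum_filter]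
    exact Finset.sum_congr rfl fun i _ => by split_ifs <;> rfl
  rw [hnot] at hD
  have h1S : 1 ∈ S := Finset.mem_filter.2 ⟨Finset.mem_range.2 (by omega), h1⟩
  have hsS : s ∈ S.erase 1 :=
    Finset.mem_erase.2 ⟨by omega, Finset.mem_filter.2 ⟨Finset.mem_range.2 (by omega), h2⟩⟩
  have hsumS : ∑ i ∈ S, min i (d - i) ≤ 2 + (S.card - 2) * (d / 2) := by
    rw [← Finset.add_sum_erase _ _ h1S, ← Finset.add_sum_erase _ _ hsS]
    have hle := Finset.sum_le_card_nsmul ((S.erase 1).erase s) (fun i => min i (d - i)) (d / 2)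
      fun i _ => by omega
    rw [Finset.card_erase_of_mem hsS, Finset.card_erase_of_mem h1S, smul_eq_mul,
      Nat.sub_sub, one_add_one_eq_two] at hle
    omega
  generalize Fintype.card V = n at *
  obtain ⟨j, rfl⟩ := Nat.exists_eq_add_of_le hn
  have hmul : (S.card - 2) * (d / 2) ≤ (j + 1) * (d / 2) := Nat.mul_le_mul_right _ (by omega)
  rw [Nat.lt_iff_add_one_le, Nat.le_div_iff_mul_le (by norm_num)]
  rcases Nat.even_or_odd' d with ⟨e, rfl | rfl⟩
  · have e1 : (2 * e) ^ 2 / 4 = e * e := by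
      rw [show (2 * e) ^ 2 = e * e * 4 by ring, Nat.mul_div_cancel _ (by norm_num)]
    have e2 : 2 * e / 2 = e := by omega
    rw [e2] at hmul hsumS
    rw [e1] at hsplit
    have e3 : 3 * (2 * e + 4 + j) ^ 2 = 12 * (e * e) + 36 * e + 12 * (e * j) + 3 * (j * j) +
      18 * j + 16 + 8 + 6 * (2 * e + 4 + j) := by ring
    have e4 : 2 * e * (2 * e + 4 + j) = 4 * (e * e) + 8 * e + 2 * (e * j) := by ring
    have e5 : (j + 1) * e = e * j + e := by ring
    rw [e3]
    rw [e4] at hD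
    rw [e5] at hmul
    omega
  · have e1 : (2 * e + 1) ^ 2 / 4 = e * e + e := by
      rw [show (2 * e + 1) ^ 2 = 4 * (e * e + e) + 1 by ring]
      omega
    have e2 : (2 * e + 1) / 2 = e := by omega
    rw [e2] at hmul hsumS
    rw [e1] at hsplit
    have e3 : 3 * (2 * e + 1 + 4 + j) ^ 2 = 12 * (e * e) + 48 * e + 12 * (e * j) + 3 * (j * j) +
      24 * j + 37 + 8 + 6 * (2 * e + 1 + 4 + j) := by ring
    have e4 : (2 * e + 1) * (2 * e + 1 + 4 + j) =
      4 * (e * e) + 12 * e + 2 * (e * j) + 5 + j := by ring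
    have e5 : (j + 1) * e = e * j + e := by ring
    rw [e3]
    rw [e4] at hD
    rw [e5] at hmul
    omega

open Classical in
/-- The layers of a graph of diameter `n - 3`, two of which are known to have two vertices. -/
theorem card_layer_of_card_eq (hG : G.Connected) {d : ℕ} {a y : V}
    (hmax : ∀ w, G.dist a w ≤ d) (hy : G.dist a y = d) {s t : ℕ} (hs : s ≤ d) (ht : t ≤ d)
    (hst : t ≠ s) (h1 : 2 ≤ (Finset.univ.filter fun v => G.dist a v = t).card)
    (h2 : 2 ≤ (Finset.univ.filter fun v => G.dist a v = s).card) :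
    d + 3 ≤ Fintype.card V ∧ (Fintype.card V = d + 3 → ∀ i ≤ d,
      (Finset.univ.filter fun v => G.dist a v = i).card = if i = t ∨ i = s then 2 else 1) := by
  have hpos : ∀ i ≤ d, _ := fun i hi => one_le_card_layer (i := i) hG (hy ▸ hi)
  constructor
  · have := sum_le_card_of_le_card_layers (G := G) hmax
      (c := fun i => 1 + (if i = t then 1 else 0) + if i = s then 1 else 0) fun i hi => by
        have := hpos i hi
        split_ifs with hit his his <;> subst_vars <;> omega
    simp [Finset.sum_add_distrib, hs, ht] at this
    omega
  · intro hn i hi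
    by_contra hne
    have := sum_le_card_of_le_card_layers (G := G) hmax
      (c := fun j => 1 + (if j = t then 1 else 0) + (if j = s then 1 else 0) +
        if j = i then 1 else 0) fun j hj => by
        have := hpos j hj
        split_ifs at hne ⊢ <;> subst_vars <;> omega
    simp [Finset.sum_add_distrib, hs, ht, hi] at this
    omega

set_option maxHeartbeats 1000000 in
/-- Recognition of two triangles joined by a path from the distances to one of the vertices. -/
theorem nonempty_iso_C33 (hG : G.Connected) {d : ℕ} (hd : 4 ≤ d)
    (hcard : Fintype.card V = d + 3) {a q z : V} (hmax : ∀ w, G.dist a w ≤ d)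
    (hq : G.dist a q = 1) (hz : G.dist a z = d)
    (hlayer : ∀ u v, G.dist a u = G.dist a v → u ≠ q → u ≠ z → v ≠ q → v ≠ z → u = v)
    (hq1 : ∀ v, G.dist a v = 1 → v ≠ q → G.Adj q v)
    (hq2 : ∀ v, G.dist a v = 2 → ¬ G.Adj q v)
    (hzd : ∀ v, G.dist a v = d → v ≠ z → G.Adj z v) :
    Nonempty (G ≃g C33 (d + 3)) := by
  classical
  have hzero : ∀ v, G.dist a v = 0 ↔ v = a := fun v => by
    rw [hG.dist_eq_zero_iff, eq_comm]
  have hadj : ∀ u v, G.Adj u v ↔ (G.dist a v = G.dist a u + 1 ∧ u ≠ q) ∨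
      (G.dist a u = G.dist a v + 1 ∧ v ≠ q) ∨ (G.dist a u = G.dist a v ∧ u ≠ v) := by
    have key : ∀ u v, G.dist a v = G.dist a u + 1 → u ≠ q → G.Adj u v := by
      intro u v h hu
      obtain ⟨u', hu', hadj⟩ := exists_adj_of_dist_eq_add_one hG h
      have := hmax v
      have : u' ≠ q := by
        rintro rfl
        exact hq2 v (by omega) hadj
      rwa [hlayer u u' hu'.symm hu (by rintro rfl; omega) this (by rintro rfl; omega)]
    intro u v
    constructor
    · intro h
      have h₁ := dist_le_dist_add_one hG (a := a) h
      have h₂ := dist_le_dist_add_one hG (a := a) h.symm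
      rcases lt_trichotomy (G.dist a u) (G.dist a v) with hlt | heq | hlt
      · refine Or.inl ⟨by omega, ?_⟩
        rintro rfl
        exact hq2 v (by omega) h
      · exact Or.inr (Or.inr ⟨heq, h.ne⟩)
      · refine Or.inr (Or.inl ⟨by omega, ?_⟩)
        rintro rfl
        exact hq2 u (by omega) h.symm
    · rintro (⟨h, hu⟩ | ⟨h, hv⟩ | ⟨h, hne⟩)
      · exact key u v h hu
      · exact (key v u h hv).symm
      · by_cases h₁ : u = q
        · subst h₁
          exact hq1 v (by omega) hne.symm
        by_cases h₂ : v = q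
        · subst h₂
          exact (hq1 u (by omega) hne).symm
        by_cases h₃ : u = z
        · subst h₃
          exact hzd v (by omega) hne.symm
        by_cases h₄ : v = z
        · subst h₄
          exact (hzd u (by omega) hne).symm
        exact absurd (hlayer u v h h₁ h₃ h₂ h₄) hne
  let f : V → ℕ := fun v =>
    if v = a then 0 else if v = q then 1 else if v = z then d + 2 else G.dist a v + 1
  have hf : ∀ v, (v = a ∧ G.dist a v = 0 ∧ v ≠ q ∧ v ≠ z ∧ f v = 0) ∨
      (v = q ∧ G.dist a v = 1 ∧ v ≠ a ∧ v ≠ z ∧ f v = 1) ∨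
      (v = z ∧ G.dist a v = d ∧ v ≠ a ∧ v ≠ q ∧ f v = d + 2) ∨
      (v ≠ a ∧ v ≠ q ∧ v ≠ z ∧ 1 ≤ G.dist a v ∧ G.dist a v ≤ d ∧ f v = G.dist a v + 1) := by
    intro v
    have haq : a ≠ q := by rintro rfl; simp at hq
    have haz : a ≠ z := by rintro rfl; simp at hz; omega
    have hqz : q ≠ z := by rintro rfl; omega
    have hv := hzero v
    have := hmax v
    simp only [f]
    by_cases h₁ : v = a
    · subst h₁
      simp [haq, haz]
    by_cases h₂ : v = q
    · subst h₂
      simp [hqz, haq.symm, hq]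
    by_cases h₃ : v = z
    · subst h₃
      simp [haz.symm, hqz.symm, hz]
    have : G.dist a v ≠ 0 := fun h => h₁ (hv.1 h)
    refine Or.inr (Or.inr (Or.inr ⟨h₁, h₂, h₃, by omega, hmax v, ?_⟩))
    simp only [h₁, h₂, h₃, if_false]
  have hinj : ∀ u v, f u = f v → u = v := by
    intro u v h
    rcases hf u with hu | hu | hu | hu <;> rcases hf v with hv | hv | hv | hv <;> try omega
    · rw [hu.1, hv.1]
    · rw [hu.1, hv.1]
    · rw [hu.1, hv.1]
    · exact hlayer u v (by omega) hu.2.1 hu.2.2.1 hv.2.1 hv.2.2.1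
  have hf1 : ∀ v, v = q ↔ f v = 1 := by
    intro v
    have := hf v
    constructor
    · intro h
      simp only [h, ne_eq, not_true_eq_false, false_and, and_false, or_false, false_or] at this ⊢
      exact this.2.2.2.2
    · intro h
      by_contra hne
      simp only [hne, false_and, false_or] at this
      omega
  have hlt : ∀ v, f v < d + 3 := fun v => by
    have := hf v
    omega
  let F : V → Fin (d + 3) := fun v => ⟨f v, hlt v⟩
  have hF : Function.Bijective F := by
    rw [Fintype.bijective_iff_injective_and_card]
    exact ⟨fun u v h => hinj u v (Fin.mk.inj_iff.1 h), by simpa using hcard⟩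
  refine ⟨⟨Equiv.ofBijective F hF, ?_⟩⟩
  intro u v
  have huv : u = v ↔ f u = f v := ⟨fun h => h ▸ rfl, hinj u v⟩
  simp only [C33, SimpleGraph.fromRel_adj, Equiv.ofBijective_apply, F, ne_eq, Fin.mk.injEq]
  rw [hadj u v, ne_eq, ne_eq, ne_eq, huv, hf1 u, hf1 v]
  rcases hf u with ⟨-, hu, -, -, hu'⟩ | ⟨-, hu, -, -, hu'⟩ | ⟨-, hu, -, -, hu'⟩ |
      ⟨-, -, -, hu, hud, hu'⟩ <;>
    rcases hf v with ⟨-, hv, -, -, hv'⟩ | ⟨-, hv, -, -, hv'⟩ | ⟨-, hv, -, -, hv'⟩ |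
      ⟨-, -, -, hv, hvd, hv'⟩ <;>
    rw [hu', hv'] <;> clear hu' hv' huv <;> omega

open Classical in
/-- The case of diameter `n - 3`. -/
theorem totalEcc_le_of_card_eq (hG : G.Connected) (hpend : ∀ v, ¬ IsPendant G v) {d : ℕ}
    (hmax : ∀ u w, G.dist u w ≤ d) {a y : V} (hy : G.dist a y = d) (hd : 4 ≤ d)
    (hcard : Fintype.card V = d + 3) {s : ℕ} (hs : s ≤ d) (hs' : d ≤ s + 1)
    (h1 : 2 ≤ (Finset.univ.filter fun v => G.dist a v = 1).card)
    (h2 : 2 ≤ (Finset.univ.filter fun v => G.dist a v = s).card) :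
    totalEcc G + d ^ 2 / 4 ≤ d * (d + 3) ∧
      (totalEcc G + d ^ 2 / 4 = d * (d + 3) → Nonempty (G ≃g C33 (d + 3))) := by
  have := hG.nonempty
  have hle : ∀ v, ecc G v ≤ d := fun v => ecc_le_s10 (hmax v)
  have hlayers := (card_layer_of_card_eq hG (hmax a) hy hs (by omega) (by omega) h1 h2).2 hcard
  have hsing : ∀ u v, G.dist a u = G.dist a v → G.dist a u ≠ 1 → G.dist a u ≠ s → u = v := by
    intro u v h hu1 hus
    have := hlayers _ (hmax a u)
    rw [if_neg (by tauto)] at this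
    exact Finset.card_le_one.1 this.le u (by simp) v (by simp [h])
  have hpair : ∀ i ≤ d, i = 1 ∨ i = s → ∀ u, G.dist a u = i → ∃ v, v ≠ u ∧
      (Finset.univ.filter fun v => G.dist a v = i) = {u, v} := by
    intro i hi his u hu
    have hc := hlayers i hi
    rw [if_pos his] at hc
    have hmem : u ∈ Finset.univ.filter fun v => G.dist a v = i := by simp [hu]
    obtain ⟨v, hv⟩ := Finset.card_eq_one.1
      ((Finset.card_erase_of_mem hmem).trans (by rw [hc]))
    refine ⟨v, ?_, by rw [← hv, Finset.insert_erase hmem]⟩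
    rintro rfl
    have := Finset.mem_singleton_self v
    rw [← hv] at this
    simp at this
  obtain ⟨x₂, hx₂, -⟩ := exists_dist_eq_on_geodesic hG (a := a) (u := a) (w := y) (i := 2)
    (by simp) (by omega)
  obtain ⟨p, hp, hpx⟩ := exists_adj_of_dist_eq_add_one hG hx₂
  obtain ⟨q, hqp, hL1⟩ := hpair 1 (by omega) (Or.inl rfl) p hp
  have hmem1 : ∀ v, G.dist a v = 1 ↔ v = p ∨ v = q := fun v => by
    simpa using Finset.ext_iff.1 hL1 v
  have hq : G.dist a q = 1 := (hmem1 q).2 (Or.inr rfl)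
  have hfirst : ∀ v, G.dist a v = 1 → G.Adj v x₂ → ecc G v + 1 ≤ d := by
    intro v hv hvx
    suffices ecc G v ≤ d - 1 by omega
    refine ecc_le_s10 fun w => ?_
    rcases le_or_gt 2 (G.dist a w) with hw | hw
    · have h₁ := dist_add_dist_eq_of_layer hG (x := x₂)
        (fun w hw => hsing w x₂ hw (by omega) (by omega)) (hx₂.trans_le hw)
      have h₂ := hG.dist_triangle (u := v) (v := x₂) (w := w)
      rw [SimpleGraph.dist_eq_one_iff_adj.2 hvx] at h₂
      have := hmax a w
      omega
    · have := hG.dist_triangle (u := v) (v := a) (w := w)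
      rw [SimpleGraph.dist_comm (u := v) (v := a)] at this
      omega
  have hlast : s + 1 = d → ∀ v, G.dist a v = s → ecc G v + 1 ≤ d := by
    intro hsd v hv
    suffices ecc G v ≤ d - 1 by omega
    obtain ⟨x, hx, hxv⟩ := exists_adj_of_dist_eq_add_one hG (a := a) (v := v) (i := d - 2)
      (by omega)
    refine ecc_le_s10 fun w => ?_
    have h₁ := dist_add_min_le hG hmax hy (x := x)
      (fun w hw => hsing w x hw (by omega) (by omega)) w
    have h₂ := hG.dist_triangle (u := v) (v := x) (w := w)
    rw [SimpleGraph.dist_eq_one_iff_adj.2 hxv.symm] at h₂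
    omega
  have hlayer : ∀ i ≤ d, (∑ v with G.dist a v = i, ecc G v) + min i (d - i) ≤
      d * (Finset.univ.filter fun v => G.dist a v = i).card := by
    intro i hi
    by_cases hi1 : i = 1
    · subst hi1
      rw [hL1, Finset.sum_pair hqp.symm, Finset.card_pair hqp.symm]
      have := hfirst p hp hpx
      have := hle q
      omega
    by_cases his : i = s
    · obtain ⟨u, hu, -⟩ := exists_dist_eq_on_geodesic hG (a := a) (u := a) (w := y) (i := s)
        (by simp) (by omega)
      obtain ⟨v, hvu, hLs⟩ := hpair i hi (Or.inr his) u (by omega)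
      rw [hLs, Finset.sum_pair hvu.symm, Finset.card_pair hvu.symm]
      have := hle u
      have := hle v
      rcases hs.eq_or_lt with hsd | hsd
      · omega
      · have := hlast (by omega) u hu
        omega
    · exact sum_layer_ecc_add_min_le hG hmax hy (by rw [hlayers i hi, if_neg (by tauto)])
  have hstrict : ∀ t ≤ d, t = 1 ∨ t = s → min t (d - t) ≤ 1 →
      (∀ v, G.dist a v = t → ecc G v + 1 ≤ d) → totalEcc G + d ^ 2 / 4 < d * (d + 3) := by
    intro t htd hts hmin ht
    have := totalEcc_add_sum_le (G := G) (hmax a)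
      (D := fun i => min i (d - i) + if i = t then 1 else 0) (by
        intro i hi
        split_ifs with hit
        · subst hit
          have hc := hlayers i htd
          rw [if_pos hts] at hc
          have hsum := Finset.sum_le_card_nsmul (Finset.univ.filter fun v => G.dist a v = i)
            (fun v => ecc G v) (d - 1) fun v hv => by
              have := ht v (by simpa using hv)
              omega
          rw [hc, smul_eq_mul] at hsum
          rw [hc]
          omega
        · exact hlayer i hi)
    rw [Finset.sum_add_distrib, sum_min_sub, hcard] at this
    simp [htd] at this
    omega
  have hbound := totalEcc_add_sum_le (G := G) (hmax a) hlayer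
  rw [sum_min_sub, hcard] at hbound
  refine ⟨hbound, fun heq => ?_⟩
  have hqx : ¬ G.Adj q x₂ := fun hadj =>
    (hstrict 1 (by omega) (Or.inl rfl) (by omega) fun v hv => by
      rcases (hmem1 v).1 hv with rfl | rfl
      exacts [hfirst _ hp hpx, hfirst _ hq hadj]).ne heq
  have hsd : s = d := by
    by_contra hne
    exact (hstrict s hs (Or.inr rfl) (by omega) (hlast (by omega))).ne heq
  subst hsd
  obtain ⟨z, hzy, hLd⟩ := hpair s le_rfl (Or.inr rfl) y hy
  have hmemd : ∀ v, G.dist a v = s ↔ v = y ∨ v = z := fun v => by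
    simpa using Finset.ext_iff.1 hLd v
  have hz : G.dist a z = s := (hmemd z).2 (Or.inr rfl)
  have hqpadj : G.Adj q p := by
    obtain ⟨b, hba, hqb⟩ := exists_ne_adj_of_not_isPendant (hpend q)
      (SimpleGraph.dist_eq_one_iff_adj.1 hq).symm
    have hb := dist_le_dist_add_one hG (a := a) hqb
    rcases (by omega : G.dist a b = 0 ∨ G.dist a b = 1 ∨ G.dist a b = 2) with h | h | h
    · exact absurd (hG.dist_eq_zero_iff.1 h).symm hba
    · rcases (hmem1 b).1 h with rfl | rfl
      exacts [hqb, absurd hqb (G.loopless.irrefl _)]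
    · rw [hsing b x₂ (by omega) (by omega) (by omega)] at hqb
      exact absurd hqb hqx
  have hzyadj : G.Adj z y := by
    obtain ⟨x, hx, hxz⟩ := exists_adj_of_dist_eq_add_one hG (a := a) (v := z) (i := s - 1)
      (by omega)
    obtain ⟨b, hbx, hzb⟩ := exists_ne_adj_of_not_isPendant (hpend z) hxz.symm
    have hb := dist_le_dist_add_one hG (a := a) hzb.symm
    have := hmax a b
    rcases (by omega : G.dist a b = s - 1 ∨ G.dist a b = s) with h | h
    · exact absurd (hsing b x (by omega) (by omega) (by omega)) hbx
    · rcases (hmemd b).1 h with rfl | rfl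
      exacts [hzb, absurd hzb (G.loopless.irrefl _)]
  refine nonempty_iso_C33 hG hd hcard (hmax a) hq hz ?_ ?_ ?_ ?_
  · intro u v h huq huz hvq hvz
    by_cases hu1 : G.dist a u = 1
    · rw [((hmem1 u).1 hu1).resolve_right huq,
        ((hmem1 v).1 (h ▸ hu1)).resolve_right hvq]
    by_cases hus : G.dist a u = s
    · rw [((hmemd u).1 hus).resolve_right huz,
        ((hmemd v).1 (h ▸ hus)).resolve_right hvz]
    exact hsing u v h hu1 hus
  · intro v hv hvq
    rwa [((hmem1 v).1 hv).resolve_right hvq]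
  · intro v hv
    rwa [hsing v x₂ (by omega) (by omega) (by omega)]
  · intro v hv hvz
    rwa [((hmemd v).1 hv).resolve_right hvz]

open Classical in
theorem two_le_card_first_layer {a y : V} (ha : ¬ IsPendant G a) (hG : G.Connected)
    (hay : 1 ≤ G.dist a y) : 2 ≤ (Finset.univ.filter fun v => G.dist a v = 1).card := by
  obtain ⟨u, hu, -⟩ := exists_dist_eq_on_geodesic hG (a := a) (u := a) (by simp) hay
  have hau := SimpleGraph.dist_eq_one_iff_adj.1 hu
  obtain ⟨b, hbu, hab⟩ := exists_ne_adj_of_not_isPendant ha hau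
  exact Finset.one_lt_card.2 ⟨b, by simp [hab], u, by simp [hau], hbu⟩

open Classical in
theorem exists_two_le_card_last_layer {a y : V} (hyp : ¬ IsPendant G y) (hG : G.Connected)
    (hmax : ∀ w, G.dist a w ≤ G.dist a y) (hay : 1 ≤ G.dist a y) :
    ∃ s ≤ G.dist a y, G.dist a y ≤ s + 1 ∧
      2 ≤ (Finset.univ.filter fun v => G.dist a v = s).card := by
  obtain ⟨x, hx, hxy⟩ := exists_adj_of_dist_eq_add_one hG (a := a) (v := y)
    (i := G.dist a y - 1) (by omega)
  obtain ⟨b, hbx, hyb⟩ := exists_ne_adj_of_not_isPendant hyp hxy.symm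
  have hb := dist_le_dist_add_one hG (a := a) hyb.symm
  refine ⟨G.dist a b, hmax b, hb, ?_⟩
  rcases (by have := hmax b; omega : G.dist a b = G.dist a x ∨ G.dist a b = G.dist a y) with h | h
  · exact Finset.one_lt_card.2 ⟨b, by simp, x, by simp [h], hbx⟩
  · exact Finset.one_lt_card.2 ⟨b, by simp, y, by simp [h], hyb.ne'⟩

end Eccentricity

-- STATEMENT 10
theorem stmt10 {V : Type*} [Fintype V] (G : SimpleGraph V) (hG : G.Connected)
    (n : ℕ) (hn : 7 ≤ n) (hcard : Fintype.card V = n)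
    (hpend : ∀ v, ¬ IsPendant G v) :
    totalEcc G ≤ (3 * n ^ 2 - 6 * n - 8) / 4 ∧
    (totalEcc G = (3 * n ^ 2 - 6 * n - 8) / 4 ↔ Nonempty (G ≃g C33 n)) := by
  classical
  suffices H : totalEcc G ≤ (3 * n ^ 2 - 6 * n - 8) / 4 ∧
      (totalEcc G = (3 * n ^ 2 - 6 * n - 8) / 4 → Nonempty (G ≃g C33 n)) by
    refine ⟨H.1, H.2, ?_⟩
    rintro ⟨e⟩
    refine le_antisymm H.1 ?_
    rw [totalEcc_congr hG e]
    exact le_totalEcc_C33 hn (e.connected_iff.1 hG)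
  have := hG.nonempty
  obtain ⟨a, y, hmax⟩ := exists_diametral_pair G
  obtain ⟨d, hy⟩ : ∃ d, G.dist a y = d := ⟨_, rfl⟩
  rcases lt_or_ge d 3 with hd | hd
  · suffices totalEcc G < (3 * n ^ 2 - 6 * n - 8) / 4 from
      ⟨this.le, fun h => absurd h this.ne⟩
    have hsum := Finset.sum_le_card_nsmul Finset.univ (fun v => ecc G v) 2
      fun v _ => ecc_le_s10 fun u => by have := hmax v u; omega
    rw [Finset.card_univ, hcard, smul_eq_mul] at hsum
    rw [totalEcc, Nat.lt_iff_add_one_le, Nat.le_div_iff_mul_le (by norm_num)]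
    have : 7 * n ≤ n ^ 2 := by nlinarith
    omega
  have h1 := two_le_card_first_layer (hpend a) hG (y := y) (by omega)
  obtain ⟨s, hs, hs', h2⟩ := exists_two_le_card_last_layer (hpend y) hG (hmax a) (by omega)
  rw [hy] at hmax hs hs'
  have hge := (card_layer_of_card_eq hG (hmax a) hy hs (by omega) (by omega) h1 h2).1
  rcases hge.eq_or_lt with heq | hlt
  · obtain rfl : n = d + 3 := by omega
    obtain ⟨hle, hiso⟩ := totalEcc_le_of_card_eq hG hpend hmax hy (by omega) hcard hs hs' h1 h2
    have hF : (3 * (d + 3) ^ 2 - 6 * (d + 3) - 8) / 4 + d ^ 2 / 4 = d * (d + 3) := by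
      have e1 : 3 * (d + 3) ^ 2 = 3 * d ^ 2 + 12 * d + 1 + 8 + 6 * (d + 3) := by ring
      have e2 : d * (d + 3) = d ^ 2 + 3 * d := by ring
      rcases Nat.even_or_odd' d with ⟨e, he | he⟩
      · have : d ^ 2 = 4 * (e * e) := by rw [he]; ring
        omega
      · have : d ^ 2 = 4 * (e * e + e) + 1 := by rw [he]; ring
        omega
    exact ⟨by omega, fun h => hiso (by omega)⟩
  · have := totalEcc_lt_of_two_le_card_layers hG hmax hy hd hlt hs hs' h1 h2
    rw [hcard] at this
    exact ⟨this.le, fun h => absurd h this.ne⟩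
end
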